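/- Let λ ≥ 1, c ≥ 0, B > 0 and δ ≥ 0. There exists a constant C ≥ 0, depending only on λ, c, B and δ, such that the following holds. Let X be a geodesic δ-hyperbolic metric space, let γ : I → X be a (λ,c)-quasi-geodesic defined on an interval I ⊆ ℝ with image Γ = γ(I), and let α : [a,b] → X be a (λ,c)-quasi-geodesic defined on a closed bounded interval with image A = α([a,b]). Then for any points p, q ∈ Γ such that p is a 1-approximate nearest point of α(a) on Γ and q is a 1-approximate nearest point of α(b) on Γ, one has d(p,q) ≥ diam(A ∩ N_B(Γ)) − C, where N_B(Γ) denotes the closed B-neighborhood of Γ. -/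

import Mathlib

/-- `γ` is a geodesic from `x` to `y`. -/
def IsGeodesicFrom {X : Type*} [MetricSpace X] (γ : ℝ → X) (x y : X) : Prop :=
  γ 0 = x ∧ γ (dist x y) = y ∧
    ∀ s ∈ Set.Icc (0 : ℝ) (dist x y), ∀ t ∈ Set.Icc (0 : ℝ) (dist x y),
      dist (γ s) (γ t) = |s - t|

/-- A metric space is geodesic if any two points are joined by a geodesic. -/
def IsGeodesicSpace (X : Type*) [MetricSpace X] : Prop :=
  ∀ x y : X, ∃ γ : ℝ → X, IsGeodesicFrom γ x y

/-- A geodesic space is `δ`-hyperbolic if each side of any geodesic triangle is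
contained in the closed `δ`-neighborhood of the union of the other two sides. -/
def IsDeltaHyperbolic (X : Type*) [MetricSpace X] (δ : ℝ) : Prop :=
  ∀ x y z : X, ∀ g₁ g₂ g₃ : ℝ → X,
    IsGeodesicFrom g₁ x y → IsGeodesicFrom g₂ y z → IsGeodesicFrom g₃ x z →
    ∀ p ∈ g₁ '' Set.Icc (0 : ℝ) (dist x y),
      ∃ q ∈ (g₂ '' Set.Icc (0 : ℝ) (dist y z)) ∪ (g₃ '' Set.Icc (0 : ℝ) (dist x z)),
        dist p q ≤ δ

/-- `γ` is a `(lam, c)`-quasi-geodesic on the interval `I ⊆ ℝ`. -/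
def IsQuasiGeodesicOn {X : Type*} [MetricSpace X] (lam c : ℝ) (γ : ℝ → X)
    (I : Set ℝ) : Prop :=
  ∀ s ∈ I, ∀ t ∈ I,
    (1 / lam) * |s - t| - c ≤ dist (γ s) (γ t) ∧ dist (γ s) (γ t) ≤ lam * |s - t| + c

/-- `z` lies metrically between `x` and `y`; in a geodesic space, this says that `z` lies on some
geodesic from `x` to `y`. -/
def DistBtw {X : Type*} [MetricSpace X] (x z y : X) : Prop :=
  dist x z + dist z y = dist x y

/-- Triangles whose sides are made of metrically intermediate points are `δ`-thin. -/
def HasThinTriangles (X : Type*) [MetricSpace X] (δ : ℝ) : Prop :=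
  ∀ x y z p : X, DistBtw x p y → ∃ q, (DistBtw y q z ∨ DistBtw x q z) ∧ dist p q ≤ δ

section Between

variable {X : Type*} [MetricSpace X]

theorem DistBtw.dist_left_le {x z y : X} (h : DistBtw x z y) : dist x z ≤ dist x y := by
  unfold DistBtw at h
  linarith [dist_nonneg (x := z) (y := y)]

theorem DistBtw.dist_le {x y z w : X} (hz : DistBtw x z y) (hw : DistBtw x w y) :
    dist z w ≤ dist x y := by
  unfold DistBtw at *
  have h₁ := dist_triangle_left z w x
  have h₂ := dist_triangle_right z w y
  linarith

theorem IsGeodesicFrom.dist_left {g : ℝ → X} {x y : X} (hg : IsGeodesicFrom g x y) {t : ℝ}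
    (ht : t ∈ Set.Icc 0 (dist x y)) : dist x (g t) = t := by
  have h := hg.2.2 0 ⟨le_rfl, dist_nonneg⟩ t ht
  rwa [hg.1, zero_sub, abs_neg, abs_of_nonneg ht.1] at h

theorem IsGeodesicFrom.dist_right {g : ℝ → X} {x y : X} (hg : IsGeodesicFrom g x y) {t : ℝ}
    (ht : t ∈ Set.Icc 0 (dist x y)) : dist (g t) y = dist x y - t := by
  have h := hg.2.2 t ht (dist x y) ⟨dist_nonneg, le_rfl⟩
  rwa [hg.2.1, abs_sub_comm, abs_of_nonneg (by linarith [ht.2])] at h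

theorem IsGeodesicFrom.distBtw {g : ℝ → X} {x y : X} (hg : IsGeodesicFrom g x y) {t : ℝ}
    (ht : t ∈ Set.Icc 0 (dist x y)) : DistBtw x (g t) y := by
  unfold DistBtw
  rw [hg.dist_left ht, hg.dist_right ht]
  ring

theorem IsGeodesicFrom.continuousOn {g : ℝ → X} {x y : X} (hg : IsGeodesicFrom g x y) :
    ContinuousOn g (Set.Icc 0 (dist x y)) := by
  have h : LipschitzOnWith 1 g (Set.Icc 0 (dist x y)) :=
    LipschitzOnWith.of_dist_le_mul fun s hs t ht => by
      rw [hg.2.2 s hs t ht, Real.dist_eq, NNReal.coe_one, one_mul]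
  exact h.continuousOn

/-- In a geodesic space a metrically intermediate point lies on a geodesic. -/
theorem DistBtw.exists_isGeodesicFrom (hX : IsGeodesicSpace X) {x z y : X}
    (h : DistBtw x z y) :
    ∃ g : ℝ → X, IsGeodesicFrom g x y ∧ z ∈ g '' Set.Icc 0 (dist x y) := by
  obtain ⟨g₁, hg₁⟩ := hX x z
  obtain ⟨g₂, hg₂⟩ := hX z y
  have hd : dist x z + dist z y = dist x y := h
  have hxz := dist_nonneg (x := x) (y := z)
  have hzy := dist_nonneg (x := z) (y := y)
  set g : ℝ → X := fun t => if t ≤ dist x z then g₁ t else g₂ (t - dist x z)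
  have hfst : ∀ t, t ≤ dist x z → g t = g₁ t := fun t ht => if_pos ht
  have hsnd : ∀ t, dist x z < t → g t = g₂ (t - dist x z) := fun t ht => if_neg ht.not_ge
  have hmono : ∀ s t, 0 ≤ s → s ≤ t → t ≤ dist x y → dist (g s) (g t) = t - s := by
    intro s t hs hst ht
    rcases le_or_gt t (dist x z) with htz | htz
    · rw [hfst t htz, hfst s (hst.trans htz),
        hg₁.2.2 s ⟨hs, hst.trans htz⟩ t ⟨hs.trans hst, htz⟩, abs_sub_comm,
        abs_of_nonneg (by linarith)]
    · have ht' : t - dist x z ∈ Set.Icc 0 (dist z y) := ⟨by linarith, by linarith⟩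
      rcases le_or_gt s (dist x z) with hsz | hsz
      · have hs' : s ∈ Set.Icc 0 (dist x z) := ⟨hs, hsz⟩
        rw [hfst s hsz, hsnd t htz]
        have e₁ := hg₁.dist_left hs'
        have e₂ := hg₁.dist_right hs'
        have e₃ := hg₂.dist_left ht'
        have e₄ := hg₂.dist_right ht'
        have h₁ := dist_triangle (g₁ s) z (g₂ (t - dist x z))
        have h₂ := dist_triangle4 x (g₁ s) (g₂ (t - dist x z)) y
        linarith
      · rw [hsnd t htz, hsnd s hsz, hg₂.2.2 _ ⟨by linarith, by linarith⟩ _ ht', abs_sub_comm,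
          abs_of_nonneg (by linarith)]
        ring
  have hz : g (dist x z) = z := (hfst _ le_rfl).trans hg₁.2.1
  refine ⟨g, ⟨(hfst 0 hxz).trans hg₁.1, ?_, ?_⟩, dist x z, ⟨hxz, by linarith⟩, hz⟩
  · rcases hzy.eq_or_lt with h0 | h0
    · rw [← hd, ← h0, add_zero, hz]
      exact dist_eq_zero.1 h0.symm
    · rw [hsnd _ (by linarith), show dist x y - dist x z = dist z y by linarith, hg₂.2.1]
  · intro s hs t ht
    rcases le_total s t with hst | hst
    · rw [hmono s t hs.1 hst ht.2, abs_sub_comm, abs_of_nonneg (by linarith)]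
    · rw [dist_comm, hmono t s ht.1 hst hs.2, abs_of_nonneg (by linarith)]

theorem IsDeltaHyperbolic.hasThinTriangles {δ : ℝ} (hX : IsGeodesicSpace X)
    (hδ : IsDeltaHyperbolic X δ) : HasThinTriangles X δ := by
  intro x y z p hp
  obtain ⟨g₁, hg₁, hp₁⟩ := hp.exists_isGeodesicFrom hX
  obtain ⟨g₂, hg₂⟩ := hX y z
  obtain ⟨g₃, hg₃⟩ := hX x z
  obtain ⟨q, hq, hpq⟩ := hδ x y z g₁ g₂ g₃ hg₁ hg₂ hg₃ p hp₁
  refine ⟨q, ?_, hpq⟩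
  rcases hq with ⟨t, ht, rfl⟩ | ⟨t, ht, rfl⟩
  · exact Or.inl (hg₂.distBtw ht)
  · exact Or.inr (hg₃.distBtw ht)

theorem HasThinTriangles.quadrilateral {δ : ℝ} (hX : HasThinTriangles X δ) (hδ : 0 ≤ δ)
    {x y z : X} (x' y' : X) (hz : DistBtw x z y) :
    ∃ q, (DistBtw x q x' ∨ DistBtw x' q y' ∨ DistBtw y q y') ∧ dist z q ≤ 2 * δ := by
  obtain ⟨q, hq | hq, hzq⟩ := hX x y x' z hz
  · obtain ⟨r, hr, hqr⟩ := hX y x' y' q hq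
    exact ⟨r, Or.inr hr, by linarith [dist_triangle z q r]⟩
  · exact ⟨q, Or.inl hq, by linarith⟩

end Between

section Morse

variable {X : Type*} [MetricSpace X]

theorem IsQuasiGeodesicOn.abs_sub_le {lam c : ℝ} (hlam : 1 ≤ lam) {α : ℝ → X} {I : Set ℝ}
    (hα : IsQuasiGeodesicOn lam c α I) {s t : ℝ} (hs : s ∈ I) (ht : t ∈ I) :
    |s - t| ≤ lam * (dist (α s) (α t) + c) := by
  have h := (hα s hs t ht).1
  have hpos : 0 < lam := by linarith
  rw [one_div, sub_le_iff_le_add, inv_mul_le_iff₀ hpos] at h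
  exact h

/-- Points between two points of a coarsely Lipschitz path are logarithmically close to it. -/
theorem HasThinTriangles.exists_dist_le_of_abs_sub_le_two_pow {δ lam c : ℝ}
    (hX : HasThinTriangles X δ) (hlam : 1 ≤ lam) {α : ℝ → X} {a b : ℝ}
    (hα : IsQuasiGeodesicOn lam c α (Set.Icc a b)) (k : ℕ) :
    ∀ s ∈ Set.Icc a b, ∀ t ∈ Set.Icc a b, |s - t| ≤ 2 ^ k → ∀ z, DistBtw (α s) z (α t) →
      ∃ u ∈ Set.Icc a b, dist z (α u) ≤ k * δ + lam + c := by
  induction k with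
  | zero =>
    intro s hs t ht hst z hz
    refine ⟨s, hs, ?_⟩
    rw [pow_zero] at hst
    have h₁ := (hα s hs t ht).2
    have h₂ := hz.dist_left_le
    rw [dist_comm z, Nat.cast_zero]
    nlinarith
  | succ k ih =>
    intro s hs t ht hst z hz
    have hm : (s + t) / 2 ∈ Set.Icc a b :=
      ⟨by linarith [hs.1, ht.1], by linarith [hs.2, ht.2]⟩
    rw [pow_succ] at hst
    have hst' := abs_le.1 hst
    have key : ∀ r ∈ Set.Icc a b, |r - (s + t) / 2| ≤ 2 ^ k → ∀ q,
        DistBtw (α r) q (α ((s + t) / 2)) → dist z q ≤ δ →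
        ∃ u ∈ Set.Icc a b, dist z (α u) ≤ (k + 1 : ℕ) * δ + lam + c := by
      intro r hr hrm q hq hzq
      obtain ⟨u, hu, hqu⟩ := ih r hr _ hm hrm q hq
      refine ⟨u, hu, ?_⟩
      push_cast
      linarith [dist_triangle z q (α u)]
    obtain ⟨q, hq | hq, hzq⟩ := hX _ _ (α ((s + t) / 2)) z hz
    · exact key t ht (abs_le.2 ⟨by linarith, by linarith⟩) q hq hzq
    · exact key s hs (abs_le.2 ⟨by linarith, by linarith⟩) q hq hzq

/-- A quantity bounded by a logarithm of itself is bounded. -/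
theorem exists_bound_of_le_log {δ lam c : ℝ} (hlam : 1 ≤ lam) (hδ : 0 ≤ δ) (hc : 0 ≤ c) :
    ∃ D₀ : ℝ, 0 ≤ D₀ ∧ ∀ D : ℝ,
      (∀ k : ℕ, lam * (6 * D + 6 + c) ≤ 2 ^ k → D ≤ 2 * δ + (k * δ + lam + c)) → D ≤ D₀ := by
  have hlin : ∀ A E : ℝ, ∃ N : ℕ, ∀ k ≥ N, A * k + E ≤ 2 ^ k := by
    intro A E
    have h₁ := (tendsto_pow_const_div_const_pow_of_one_lt 1 (one_lt_two (α := ℝ))).const_mul A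
    have h₀ := (tendsto_pow_const_div_const_pow_of_one_lt 0 (one_lt_two (α := ℝ))).const_mul E
    have h := h₁.add h₀
    rw [mul_zero, mul_zero, add_zero] at h
    obtain ⟨N, hN⟩ := Filter.eventually_atTop.1 (h.eventually_lt_const one_pos)
    refine ⟨N, fun k hk => ?_⟩
    have := hN k hk
    rw [pow_one, pow_zero, ← mul_div_assoc, ← mul_div_assoc, ← add_div,
      div_lt_one (by positivity)] at this
    linarith
  obtain ⟨N, hN⟩ := hlin (lam * 6 * δ) (lam * (6 * (3 * δ + lam + c) + 6 + c))
  refine ⟨2 * δ + (N * δ + lam + c), by positivity, fun D hD => ?_⟩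
  obtain ⟨k₀, hk₀⟩ := pow_unbounded_of_one_lt (lam * (6 * D + 6 + c)) (one_lt_two (α := ℝ))
  have hex : ∃ k : ℕ, lam * (6 * D + 6 + c) ≤ 2 ^ k := ⟨k₀, hk₀.le⟩
  classical
  have hk := hD _ (Nat.find_spec hex)
  rcases le_or_gt (Nat.find hex) N with h | h
  · have : (Nat.find hex : ℝ) * δ ≤ N * δ := by gcongr
    linarith
  · exfalso
    obtain ⟨j, hj⟩ : ∃ j, Nat.find hex = j + 1 := ⟨Nat.find hex - 1, by omega⟩
    have h₁ := not_le.1 (Nat.find_min hex (m := j) (by omega))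
    have h₂ := hN j (by omega)
    rw [hj] at hk
    push_cast at hk
    have h₃ : lam * (6 * D + 6 + c) ≤ lam * (6 * (2 * δ + ((j + 1) * δ + lam + c)) + 6 + c) := by
      gcongr
    nlinarith

/-- Geodesics stay uniformly close to quasi-geodesics with the same endpoints. -/
theorem exists_infDist_quasiGeodesic_le {δ lam c : ℝ} (hlam : 1 ≤ lam) (hδ : 0 ≤ δ)
    (hc : 0 ≤ c) :
    ∃ D₀ : ℝ, 0 ≤ D₀ ∧ ∀ (X : Type*) [MetricSpace X], HasThinTriangles X δ →
      ∀ (a b : ℝ), a ≤ b → ∀ α : ℝ → X, IsQuasiGeodesicOn lam c α (Set.Icc a b) →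
      ∀ g : ℝ → X, IsGeodesicFrom g (α a) (α b) →
      ∀ r ∈ Set.Icc 0 (dist (α a) (α b)), Metric.infDist (g r) (α '' Set.Icc a b) ≤ D₀ := by
  obtain ⟨D₀, hD₀, hbound⟩ := exists_bound_of_le_log hlam hδ hc
  refine ⟨D₀ + 2 * δ, by positivity, fun X _ hX a b hab α hα g hg => ?_⟩
  set P := α '' Set.Icc a b
  set l := dist (α a) (α b)
  have ha : α a ∈ P := ⟨a, Set.left_mem_Icc.2 hab, rfl⟩
  have hb : α b ∈ P := ⟨b, Set.right_mem_Icc.2 hab, rfl⟩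
  have hl0 : 0 ≤ l := dist_nonneg
  obtain ⟨r₀, hr₀, hmax⟩ := isCompact_Icc.exists_isMaxOn ⟨0, le_rfl, hl0⟩
    ((Metric.continuous_infDist_pt P).comp_continuousOn hg.continuousOn)
  set D := Metric.infDist (g r₀) P
  have hDmax : ∀ r ∈ Set.Icc 0 l, Metric.infDist (g r) P ≤ D := fun r hr => hmax hr
  suffices D ≤ D₀ + 2 * δ from fun r hr => (hDmax r hr).trans this
  have hD0 : 0 ≤ D := Metric.infDist_nonneg
  by_contra! hlt
  -- Near each end of the relevant subsegment, choose a point of the path.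
  have hend : ∀ r ∈ Set.Icc 0 l, (g r ∈ P ∨ 2 * D + 2 ≤ |r₀ - r|) →
      ∃ s ∈ Set.Icc a b, dist (g r) (α s) ≤ D + 1 ∧
        ∀ q, DistBtw (g r) q (α s) → D ≤ dist (g r₀) q := by
    rintro r hr (⟨s, hs, hsr⟩ | hfar)
    · refine ⟨s, hs, by rw [hsr, dist_self]; positivity, fun q hq => ?_⟩
      have h := hq.dist_left_le
      rw [hsr, dist_self] at h
      rw [← dist_le_zero.1 h]
      exact Metric.infDist_le_dist_of_mem ⟨s, hs, hsr⟩
    · obtain ⟨_, ⟨s, hs, rfl⟩, hy⟩ := (Metric.infDist_lt_iff ⟨_, ha⟩).1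
        ((hDmax r hr).trans_lt (lt_add_one D))
      refine ⟨s, hs, hy.le, fun q hq => ?_⟩
      have h₁ := hq.dist_left_le
      have h₂ := dist_triangle_right (g r₀) (g r) q
      rw [hg.2.2 r₀ hr₀ r hr] at h₂
      linarith
  have hleft : ∃ r ∈ Set.Icc 0 r₀, r₀ - r ≤ 2 * D + 2 ∧ (g r ∈ P ∨ 2 * D + 2 ≤ |r₀ - r|) := by
    rcases le_total (r₀ - (2 * D + 2)) 0 with h | h
    · exact ⟨0, ⟨le_rfl, hr₀.1⟩, by linarith, Or.inl (hg.1 ▸ ha)⟩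
    · exact ⟨r₀ - (2 * D + 2), ⟨h, by linarith⟩, by linarith,
        Or.inr (le_abs.2 (Or.inl (by linarith)))⟩
  have hright : ∃ r ∈ Set.Icc r₀ l, r - r₀ ≤ 2 * D + 2 ∧ (g r ∈ P ∨ 2 * D + 2 ≤ |r₀ - r|) := by
    rcases le_total l (r₀ + (2 * D + 2)) with h | h
    · exact ⟨l, ⟨hr₀.2, le_rfl⟩, by linarith, Or.inl (hg.2.1.symm ▸ hb)⟩
    · exact ⟨r₀ + (2 * D + 2), ⟨by linarith, h⟩, by linarith,
        Or.inr (le_abs.2 (Or.inr (by linarith)))⟩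
  obtain ⟨r₁, hr₁, hr₁', hP₁⟩ := hleft
  obtain ⟨r₂, hr₂, hr₂', hP₂⟩ := hright
  have hI₁ : r₁ ∈ Set.Icc 0 l := ⟨hr₁.1, hr₁.2.trans hr₀.2⟩
  have hI₂ : r₂ ∈ Set.Icc 0 l := ⟨hr₀.1.trans hr₂.1, hr₂.2⟩
  obtain ⟨s, hs, hys, hq₁⟩ := hend r₁ hI₁ hP₁
  obtain ⟨t, ht, hwt, hq₂⟩ := hend r₂ hI₂ hP₂
  have d₁₂ : dist (g r₁) (g r₂) = r₂ - r₁ := by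
    rw [hg.2.2 r₁ hI₁ r₂ hI₂, abs_sub_comm, abs_of_nonneg (by linarith [hr₁.2, hr₂.1])]
  have hbtw : DistBtw (g r₁) (g r₀) (g r₂) := by
    unfold DistBtw
    rw [d₁₂, hg.2.2 r₁ hI₁ r₀ hr₀, hg.2.2 r₀ hr₀ r₂ hI₂,
      abs_of_nonpos (by linarith [hr₁.2]), abs_of_nonpos (by linarith [hr₂.1])]
    ring
  obtain ⟨q, hq | hq | hq, hzq⟩ := hX.quadrilateral hδ (α s) (α t) hbtw
  · linarith [hq₁ q hq]
  · have hst : |s - t| ≤ lam * (6 * D + 6 + c) := by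
      refine (hα.abs_sub_le hlam hs ht).trans ?_
      have h₁ := dist_triangle4 (α s) (g r₁) (g r₂) (α t)
      rw [dist_comm (α s) (g r₁)] at h₁
      gcongr
      linarith
    have : D ≤ D₀ := hbound D fun k hk => by
      obtain ⟨u, hu, hqu⟩ :=
        hX.exists_dist_le_of_abs_sub_le_two_pow hlam hα k s hs t ht (hst.trans hk) q hq
      have h₁ : D ≤ dist (g r₀) (α u) := Metric.infDist_le_dist_of_mem ⟨u, hu, rfl⟩
      linarith [dist_triangle (g r₀) q (α u)]
    linarith
  · linarith [hq₂ q hq]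

/-- Quasi-geodesics stay uniformly close to geodesics with the same endpoints. -/
theorem exists_distBtw_dist_quasiGeodesic_le {δ lam c : ℝ} (hlam : 1 ≤ lam) (hδ : 0 ≤ δ)
    (hc : 0 ≤ c) :
    ∃ K : ℝ, 0 ≤ K ∧ ∀ (X : Type*) [MetricSpace X], IsGeodesicSpace X → HasThinTriangles X δ →
      ∀ (a b : ℝ), a ≤ b → ∀ α : ℝ → X, IsQuasiGeodesicOn lam c α (Set.Icc a b) →
      ∀ t ∈ Set.Icc a b, ∃ z, DistBtw (α a) z (α b) ∧ dist (α t) z ≤ K := by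
  obtain ⟨D₀, hD₀, hclose⟩ := exists_infDist_quasiGeodesic_le hlam hδ hc
  refine ⟨lam * (lam * (2 * (D₀ + 1) + c)) + c + (D₀ + 1), by positivity,
    fun X _ hG hX a b hab α hα t ht => ?_⟩
  obtain ⟨g, hg⟩ := hG (α a) (α b)
  have hab' := hclose X hX a b hab α hα g hg
  set l := dist (α a) (α b)
  have hl0 : 0 ≤ l := dist_nonneg
  have hat : α a ∈ α '' Set.Icc a t := ⟨a, Set.left_mem_Icc.2 ht.1, rfl⟩
  have hbt : α b ∈ α '' Set.Icc t b := ⟨b, Set.right_mem_Icc.2 ht.2, rfl⟩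
  have hclosed : ∀ S : Set X,
      IsClosed (Set.Icc 0 l ∩ {r | Metric.infDist (g r) S ≤ D₀}) := fun S =>
    ((Metric.continuous_infDist_pt S).comp_continuousOn hg.continuousOn).preimage_isClosed_of_isClosed
      isClosed_Icc isClosed_Iic
  have hcover : Set.Icc 0 l ⊆ (Set.Icc 0 l ∩ {r | Metric.infDist (g r) (α '' Set.Icc a t) ≤ D₀}) ∪
      (Set.Icc 0 l ∩ {r | Metric.infDist (g r) (α '' Set.Icc t b) ≤ D₀}) := by
    intro r hr
    by_contra hcon
    simp only [Set.mem_union, Set.mem_inter_iff, hr, true_and, Set.mem_ofPred_eq, not_or,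
      not_le] at hcon
    obtain ⟨_, ⟨u, hu, rfl⟩, hlt⟩ :=
      (Metric.infDist_lt_iff ((Set.nonempty_Icc.2 hab).image α)).1
        ((hab' r hr).trans_lt (lt_min hcon.1 hcon.2))
    rcases le_total u t with hut | hut
    · exact (lt_min_iff.1 hlt).1.not_ge (Metric.infDist_le_dist_of_mem ⟨u, ⟨hu.1, hut⟩, rfl⟩)
    · exact (lt_min_iff.1 hlt).2.not_ge (Metric.infDist_le_dist_of_mem ⟨u, ⟨hut, hu.2⟩, rfl⟩)
  have hmeet := isPreconnected_closed_iff.1 isPreconnected_Icc _ _ (hclosed _) (hclosed _) hcover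
  obtain ⟨r, hr, ⟨-, h₁⟩, ⟨-, h₂⟩⟩ := hmeet
    ⟨0, Set.left_mem_Icc.2 hl0, Set.left_mem_Icc.2 hl0, by
      rw [Set.mem_ofPred_eq, hg.1, Metric.infDist_zero_of_mem hat]; exact hD₀⟩
    ⟨l, Set.right_mem_Icc.2 hl0, Set.right_mem_Icc.2 hl0, by
      rw [Set.mem_ofPred_eq, hg.2.1, Metric.infDist_zero_of_mem hbt]; exact hD₀⟩
  obtain ⟨_, ⟨u, hu, rfl⟩, hu'⟩ :=
    (Metric.infDist_lt_iff ⟨_, hat⟩).1 (lt_of_le_of_lt h₁ (lt_add_one D₀))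
  obtain ⟨_, ⟨v, hv, rfl⟩, hv'⟩ :=
    (Metric.infDist_lt_iff ⟨_, hbt⟩).1 (lt_of_le_of_lt h₂ (lt_add_one D₀))
  refine ⟨g r, hg.distBtw hr, ?_⟩
  have hu₁ : u ∈ Set.Icc a b := ⟨hu.1, hu.2.trans ht.2⟩
  have hv₁ : v ∈ Set.Icc a b := ⟨ht.1.trans hv.1, hv.2⟩
  have huv : |u - v| ≤ lam * (2 * (D₀ + 1) + c) := by
    refine (hα.abs_sub_le hlam hu₁ hv₁).trans ?_
    gcongr
    linarith [dist_triangle_left (α u) (α v) (g r)]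
  have htu : |t - u| ≤ lam * (2 * (D₀ + 1) + c) := by
    have := neg_abs_le (u - v)
    rw [abs_of_nonneg (by linarith [hu.2])]
    linarith [hv.1]
  have h₃ := (hα t ht u hu₁).2
  have h₄ : lam * |t - u| ≤ lam * (lam * (2 * (D₀ + 1) + c)) := by gcongr
  have h₅ := dist_triangle_right (α t) (g r) (α u)
  linarith

end Morse

/-- If `p` is an approximate nearest point to `x` on `S`, then any point `w` near `S` and near a
point between `x` and `p` is near `p`. -/
theorem DistBtw.dist_le_of_approx_nearest {X : Type*} [MetricSpace X] {S : Set X} {x p z w y : X}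
    {B K : ℝ} (hz : DistBtw x z p) (hp : dist x p ≤ Metric.infDist x S + 1) (hy : y ∈ S)
    (hwy : dist w y ≤ B) (hwz : dist w z ≤ K) : dist w p ≤ 2 * K + B + 1 := by
  have h₁ : Metric.infDist x S ≤ dist x y := Metric.infDist_le_dist_of_mem hy
  have h₂ := dist_triangle x z y
  have h₃ := dist_triangle_left z y w
  have h₄ := dist_triangle w z p
  unfold DistBtw at hz
  linarith

theorem projection_bound_in_hyperbolic_space
    (lam c B δ : ℝ) (hlam : 1 ≤ lam) (hc : 0 ≤ c) (hB : 0 < B) (hδ : 0 ≤ δ) :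
    ∃ C : ℝ, 0 ≤ C ∧
      ∀ (X : Type*) [MetricSpace X], IsGeodesicSpace X → IsDeltaHyperbolic X δ →
        ∀ (I : Set ℝ), I.OrdConnected →
        ∀ γ : ℝ → X, IsQuasiGeodesicOn lam c γ I →
        ∀ a b : ℝ, a ≤ b →
        ∀ α : ℝ → X, IsQuasiGeodesicOn lam c α (Set.Icc a b) →
        ∀ p ∈ γ '' I, ∀ q ∈ γ '' I,
          dist (α a) p ≤ Metric.infDist (α a) (γ '' I) + 1 →
          dist (α b) q ≤ Metric.infDist (α b) (γ '' I) + 1 →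
          Metric.diam ((α '' Set.Icc a b) ∩
              {x : X | ∃ y ∈ γ '' I, dist x y ≤ B}) - C ≤ dist p q := by
  obtain ⟨K, hK, hmorse⟩ := exists_distBtw_dist_quasiGeodesic_le hlam hδ hc
  set M := 2 * (K + 2 * δ) + B + 1
  refine ⟨2 * M, by positivity, ?_⟩
  intro X _ hG hH I _ γ _ a b hab α hα p _ q _ hp hq
  have hX := hH.hasThinTriangles hG
  have key : ∀ x ∈ (α '' Set.Icc a b) ∩ {x : X | ∃ y ∈ γ '' I, dist x y ≤ B},
      ∃ z, DistBtw p z q ∧ dist x z ≤ M := by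
    rintro _ ⟨⟨t, ht, rfl⟩, y, hy, hxy⟩
    obtain ⟨z, hz, htz⟩ := hmorse X hG hX a b hab α hα t ht
    obtain ⟨w, hw, hzw⟩ := hX.quadrilateral hδ p q hz
    have htw : dist (α t) w ≤ K + 2 * δ := by linarith [dist_triangle (α t) z w]
    rcases hw with hw | hw | hw
    · exact ⟨p, by simp [DistBtw], hw.dist_le_of_approx_nearest hp hy hxy htw⟩
    · exact ⟨w, hw, by linarith⟩
    · exact ⟨q, by simp [DistBtw], hw.dist_le_of_approx_nearest hq hy hxy htw⟩
  rw [sub_le_iff_le_add]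
  refine Metric.diam_le_of_forall_dist_le (by positivity) fun x hx y hy => ?_
  obtain ⟨z, hz, hxz⟩ := key x hx
  obtain ⟨w, hw, hyw⟩ := key y hy
  have h := dist_triangle4 x z w y
  rw [dist_comm w] at h
  linarith [hz.dist_le hw]
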